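/- Let A be the symmetric adjacency matrix of the multigraph obtained from the 2221 base graph by adding one new vertex w joined to u₂ by a double edge (so the (w,u₂) and (u₂,w) entries of A equal 2). Then A has an eigenvalue strictly larger than √((5+√21)/2): there exist a real number μ > √((5+√21)/2) and a nonzero real vector v with A·v = μ·v. -/

import Mathlib

open Matrix

/-- 2221 base graph; vertex 6 is joined to 4 by a double edge. -/
def edgesDouble2221 : List (Fin 7 × Fin 7) :=
  [(0,1),(1,2),(2,3),(2,4),(2,5)]

/-- Adjacency matrix of the multigraph: entry is the number of edges between the vertices;
the pair (4, 6) is joined by a double edge. -/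
def adjDouble2221 : Matrix (Fin 7) (Fin 7) ℝ :=
  fun i j =>
    if (i, j) ∈ edgesDouble2221 ∨ (j, i) ∈ edgesDouble2221 then 1
    else if (i, j) = (4, 6) ∨ (i, j) = (6, 4) then 2
    else 0

/-- The cubic satisfied by the squares of the nonzero eigenvalues has a root in `(6, 7)`. -/
lemma exists_root_cubicDouble2221 :
    ∃ t : ℝ, 6 < t ∧ t ^ 3 - 9 * t ^ 2 + 19 * t - 8 = 0 := by
  have hcont : ContinuousOn (fun t : ℝ => t ^ 3 - 9 * t ^ 2 + 19 * t - 8) (Set.Icc 6 7) := by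
    fun_prop
  obtain ⟨t, ht, h⟩ := intermediate_value_Ioo (by norm_num) hcont
    (show (0 : ℝ) ∈ Set.Ioo _ _ by constructor <;> norm_num)
  exact ⟨t, ht.1, h⟩

/-- An explicit eigenvector for an eigenvalue whose square is a root of the cubic. -/
lemma adjDouble2221_mulVec_of_root {x : ℝ}
    (hx : (x ^ 2) ^ 3 - 9 * (x ^ 2) ^ 2 + 19 * x ^ 2 - 8 = 0) :
    let v : Fin 7 → ℝ := ![x * (x ^ 2 - 4), x ^ 2 * (x ^ 2 - 4), x * (x ^ 2 - 1) * (x ^ 2 - 4),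
      (x ^ 2 - 1) * (x ^ 2 - 4), x ^ 2 * (x ^ 2 - 1), (x ^ 2 - 1) * (x ^ 2 - 4),
      2 * x * (x ^ 2 - 1)]
    adjDouble2221.mulVec v = x • v := by
  have hA : adjDouble2221 = !![0, 1, 0, 0, 0, 0, 0; 1, 0, 1, 0, 0, 0, 0; 0, 1, 0, 1, 1, 1, 0;
      0, 0, 1, 0, 0, 0, 0; 0, 0, 1, 0, 0, 0, 2; 0, 0, 1, 0, 0, 0, 0; 0, 0, 0, 0, 2, 0, 0] := by
    ext i j
    fin_cases i <;> fin_cases j <;> simp [adjDouble2221, edgesDouble2221]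
  intro v
  ext i
  rw [hA]
  fin_cases i <;> simp [v, mulVec, dotProduct, Fin.sum_univ_succ]
  all_goals first | ring1 | linear_combination -hx

theorem thmDouble2221 :
    ∃ μ : ℝ, μ > Real.sqrt ((5 + Real.sqrt 21) / 2) ∧
      ∃ v : Fin 7 → ℝ, v ≠ 0 ∧ (adjDouble2221).mulVec v = μ • v := by
  obtain ⟨t, ht, hroot⟩ := exists_root_cubicDouble2221
  have hsq : √t ^ 2 = t := Real.sq_sqrt (by linarith)
  have hbound : √21 < 5 := by
    rw [Real.sqrt_lt' (by norm_num)]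
    norm_num
  refine ⟨√t, Real.sqrt_lt_sqrt (by positivity) (by linarith), _, ?_,
    adjDouble2221_mulVec_of_root (by rwa [hsq])⟩
  intro h
  have h4 := congrFun h 4
  simp only [hsq] at h4
  have : t * (t - 1) = 0 := h4
  nlinarith
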